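/- Fix a real number y > 1. Then as m → ∞, g_m(y) = (y^{1/4}·(√y + 1)/(2√π)) · (√y + 1)^{2m} / m^{3/2} · (1 + o(1)); equivalently, m^{3/2}·g_m(y)·(√y + 1)^{−2m} → y^{1/4}·(√y + 1)/(2√π). -/

import Mathlib

open Finset

/-- The height after `t` steps of the walk encoded by the step sequence `s`
(`true` = up-step `+1`, `false` = down-step `−1`). -/
def dyckHeight (m : ℕ) (s : Fin (2 * m) → Bool) (t : ℕ) : ℤ :=
  ∑ u ∈ Finset.univ.filter (fun u : Fin (2 * m) => (u : ℕ) < t),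
    (if s u then (1 : ℤ) else -1)

/-- `s` encodes a Dyck path of length `2m`: the walk `x(t) = dyckHeight m s t` satisfies
`x(0) = 0`, `x(t) ≥ 0` for all `0 ≤ t ≤ 2m`, `x(2m) = 0`, and `|x(t+1) − x(t)| = 1`. -/
def IsDyck (m : ℕ) (s : Fin (2 * m) → Bool) : Prop :=
  (∀ t : ℕ, t ≤ 2 * m → 0 ≤ dyckHeight m s t) ∧ dyckHeight m s (2 * m) = 0

/-- `#(X)`: the number of up-steps at even times of the path encoded by `s`. -/
def upEven (m : ℕ) (s : Fin (2 * m) → Bool) : ℕ :=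
  (Finset.univ.filter (fun u : Fin (2 * m) => (u : ℕ) % 2 = 0 ∧ s u = true)).card

/-- `#'(X)`: the number of up-steps at odd times of the path encoded by `s`. -/
def upOdd (m : ℕ) (s : Fin (2 * m) → Bool) : ℕ :=
  (Finset.univ.filter (fun u : Fin (2 * m) => (u : ℕ) % 2 = 1 ∧ s u = true)).card

open Classical in
/-- `g_m(y) = Σ_{X ∈ Ω_m} y^{#(X)}`, the generating polynomial of Dyck paths of length
`2m` by the number of up-steps at even times; `g_0(y) = 1`. -/
noncomputable def dyckG (m : ℕ) (y : ℝ) : ℝ :=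
  ∑ s : Fin (2 * m) → Bool, if IsDyck m s then y ^ upEven m s else 0

open Classical in
/-- `g'_m(y) = Σ_{X ∈ Ω_m} y^{#'(X)}`, the generating polynomial of Dyck paths of length
`2m` by the number of up-steps at odd times; `g'_0(y) = 1`. -/
noncomputable def dyckG' (m : ℕ) (y : ℝ) : ℝ :=
  ∑ s : Fin (2 * m) → Bool, if IsDyck m s then y ^ upOdd m s else 0


open Filter Topology

def OKW (n : ℕ) (h : ℤ) (s : Fin n → Bool) : Prop :=
  (∀ t : ℕ, t ≤ n → 0 ≤ h + ∑ u : Fin n, if (u:ℕ) < t then (if s u then (1 : ℤ) else -1) else 0) ∧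
    h + ∑ u : Fin n, (if s u then (1 : ℤ) else -1) = 0

def upW (n p : ℕ) (s : Fin n → Bool) : ℕ :=
  ∑ u : Fin n, if ((u:ℕ)+p) % 2 = 0 ∧ s u = true then 1 else 0

open Classical in
noncomputable def WW (y : ℝ) (n : ℕ) (p : ℕ) (h : ℤ) : ℝ :=
  ∑ s : Fin n → Bool, if OKW n h s then y ^ upW n p s else 0

lemma OKW_cons (n : ℕ) (h : ℤ) (hh : 0 ≤ h) (b : Bool) (s : Fin n → Bool) :
    OKW (n+1) h (Fin.cons b s : Fin (n+1) → Bool) ↔ OKW n (h + if b then 1 else -1) s := by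
  unfold OKW
  simp only [Fin.sum_univ_succ, Fin.cons_zero, Fin.cons_succ, Fin.val_succ, Fin.val_zero, add_assoc]
  refine and_congr_left fun _ => ⟨fun H t ht => ?_, fun H t ht => ?_⟩
  · simpa using H (t+1) (by omega)
  · rcases t with _ | t
    · simpa using hh
    · simpa using H t (by omega)

lemma upW_cons (n p : ℕ) (b : Bool) (s : Fin n → Bool) :
    upW (n+1) p (Fin.cons b s : Fin (n+1) → Bool) = (if p % 2 = 0 ∧ b = true then 1 else 0) + upW n (p+1) s := by
  unfold upW
  simp only [Fin.sum_univ_succ, Fin.cons_zero, Fin.cons_succ, Fin.val_succ, Fin.val_zero]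
  congr 1
  · simp
  · apply Finset.sum_congr rfl
    intro u _
    rw [show (u:ℕ)+1+p = u + (p+1) by ring]

lemma WW_neg (y : ℝ) (n p : ℕ) (h : ℤ) (hh : h < 0) : WW y n p h = 0 := by
  unfold WW
  apply Finset.sum_eq_zero
  intro s _
  rw [if_neg]
  rintro ⟨h1, _⟩
  have := h1 0 (Nat.zero_le _)
  simp at this
  omega

lemma WW_zero (y : ℝ) (p : ℕ) (h : ℤ) : WW y 0 p h = if h = 0 then 1 else 0 := by
  unfold WW
  simp [OKW, upW]
  by_cases h0 : h = 0 <;> simp [h0]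

lemma WW_succ (y : ℝ) (n p : ℕ) (h : ℤ) (hh : 0 ≤ h) :
    WW y (n+1) p h = (if p % 2 = 0 then y else 1) * WW y n (p+1) (h+1) + WW y n (p+1) (h-1) := by
  classical
  unfold WW
  rw [← (Fin.consEquiv (fun _ : Fin (n+1) => Bool)).sum_comp, Fintype.sum_prod_type, Fintype.sum_bool,
    Finset.mul_sum]
  congr 1
  · apply Finset.sum_congr rfl
    intro s _
    simp only [Fin.consEquiv, Equiv.coe_fn_mk]
    rw [mul_ite, mul_zero]
    refine if_congr (by simpa using OKW_cons n h hh true s) ?_ rfl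
    rw [upW_cons, pow_add]
    congr 1
    split_ifs <;> simp_all
  · apply Finset.sum_congr rfl
    intro s _
    simp only [Fin.consEquiv, Equiv.coe_fn_mk]
    refine if_congr (by simpa [sub_eq_add_neg] using OKW_cons n h hh false s) ?_ rfl
    rw [upW_cons]
    simp

lemma WW_two (y : ℝ) (G Q : PowerSeries ℝ) (hG : G = 1 + PowerSeries.X * (PowerSeries.C y * (G * Q) + PowerSeries.C y * G))
    (hQ : Q = PowerSeries.X * (PowerSeries.C y * Q ^ 2 + PowerSeries.C (y+1) * Q + 1)) (m : ℕ) :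
    ∀ (p k : ℕ), p % 2 = 0 → WW y (2 * m) p (2 * k) = PowerSeries.coeff m (G * Q ^ k) := by
  have hQ0 : PowerSeries.constantCoeff Q = 0 := by rw [hQ]; simp
  have hG0 : PowerSeries.constantCoeff G = 1 := by rw [hG]; simp
  induction m with
  | zero =>
    intro p k hp
    rw [Nat.mul_zero, WW_zero]
    rcases k with _ | k <;> simp [hQ0, hG0, pow_succ]
    omega
  | succ m ih =>
    intro p k hp
    have e1 : (p + 1) % 2 ≠ 0 := by omega
    have e2 : (p + 1 + 1) % 2 = 0 := by omega
    rw [show 2 * (m+1) = (2 * m + 1) + 1 by ring, WW_succ _ _ _ _ (by positivity), if_pos hp,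
      WW_succ _ _ _ _ (by positivity), if_neg e1]
    rw [show (2 * (k:ℤ) + 1 + 1) = 2 * ((k+1 : ℕ):ℤ) by push_cast; ring, ih _ _ e2,
      show (2 * (k:ℤ) + 1 - 1) = 2 * (k:ℤ) by ring, ih _ _ e2]
    rcases k with _ | k
    · rw [WW_neg _ _ _ _ (by norm_num)]
      rw [pow_zero, mul_one]
      conv_rhs => rw [hG]
      rw [map_add, PowerSeries.coeff_succ_X_mul]
      simp [PowerSeries.coeff_one]
      ring
    · rw [WW_succ _ _ _ _ (by push_cast; omega), if_neg e1,
       show (2 * ((k+1:ℕ):ℤ) - 1 + 1) = 2 * ((k+1 : ℕ):ℤ) by push_cast; ring, ih _ _ e2,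
       show (2 * ((k+1:ℕ):ℤ) - 1 - 1) = 2 * (k:ℤ) by push_cast; ring, ih _ _ e2]
      have : G * Q ^ (k+1) = PowerSeries.X * (PowerSeries.C y * (G * Q ^ (k+1+1)) + PowerSeries.C (y+1) * (G * Q^(k+1)) + G * Q ^ k) := by
        linear_combination G * Q^k * hQ
      conv_rhs => rw [this]
      rw [PowerSeries.coeff_succ_X_mul, map_add, map_add, PowerSeries.coeff_C_mul, PowerSeries.coeff_C_mul]
      ring

noncomputable def uu (n : ℕ) : ℝ := match n with
  | 0 => 1
  | n+1 => - (catalan n : ℝ) / (2 * 4 ^ n)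

lemma uu_sq : (PowerSeries.mk uu) ^ 2 = 1 - PowerSeries.X := by
  have h := congrArg (PowerSeries.map (Nat.castRingHom ℝ)) PowerSeries.catalanSeries_sq_mul_X_add_one
  have h2 := congrArg (PowerSeries.rescale (1/4:ℝ)) h
  have : PowerSeries.mk uu = 1 - PowerSeries.C (1/2:ℝ) * PowerSeries.X * PowerSeries.rescale (1/4:ℝ) ((PowerSeries.map (Nat.castRingHom ℝ)) PowerSeries.catalanSeries) := by
    ext n
    rcases n with _ | n
    · simp [uu]
    · rw [mul_assoc]
      simp [uu, PowerSeries.coeff_C_mul, PowerSeries.coeff_succ_X_mul, PowerSeries.coeff_one, PowerSeries.coeff_rescale]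
      ring
  rw [this]
  simp only [map_add, map_mul, map_pow, map_one, PowerSeries.map_X, PowerSeries.rescale_X] at h2
  set D := PowerSeries.rescale (1/4:ℝ) ((PowerSeries.map (Nat.castRingHom ℝ)) PowerSeries.catalanSeries)
  have e1 : (PowerSeries.C (1/4:ℝ)) = PowerSeries.C (1/2:ℝ) ^ 2 := by rw [← map_pow]; norm_num
  have e2 : 2 * (PowerSeries.C (1/2:ℝ)) = 1 := by
    rw [show (2 : PowerSeries ℝ) = PowerSeries.C (2:ℝ) from (map_ofNat PowerSeries.C 2).symm, ← map_mul]; norm_num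
  rw [e1] at h2
  linear_combination PowerSeries.X * h2 - D * PowerSeries.X * e2

lemma uu_sum (n : ℕ) : ∑ i ∈ range (n+1), uu i = (n.centralBinom : ℝ) / 4 ^ n := by
  induction n with
  | zero => simp [uu]
  | succ n ih =>
    rw [Finset.sum_range_succ, ih]
    simp only [uu]
    have h1 : ((n+1 : ℝ)) * catalan n = n.centralBinom := by exact_mod_cast succ_mul_catalan_eq_centralBinom n
    have h2 : ((n+1 : ℝ)) * (n+1).centralBinom = 2 * (2 * n + 1) * n.centralBinom := by exact_mod_cast Nat.succ_mul_centralBinom_succ n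
    rw [← h1] at h2 ⊢
    have h3 : ((n+1).centralBinom : ℝ) = 2 * (2 * n + 1) * catalan n := by
      have : (n+1:ℝ) ≠ 0 := by positivity
      apply mul_left_cancel₀ this
      linarith
    rw [h3]
    field_simp
    ring

lemma cb_tendsto : Tendsto (fun n : ℕ => (n.centralBinom : ℝ) / 4 ^ n * √n) atTop (𝓝 (1 / √Real.pi)) := by
  have h := Stirling.tendsto_stirlingSeq_sqrt_pi
  have h2 : Tendsto (fun n : ℕ => Stirling.stirlingSeq (2 * n)) atTop (𝓝 √Real.pi) :=
    h.comp (tendsto_id.const_mul_atTop' (by norm_num))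
  have hp : √Real.pi ≠ 0 := by positivity
  have h3 := h2.div (h.pow 2) (by positivity)
  have e : √Real.pi / √Real.pi ^ 2 = 1 / √Real.pi := by field_simp
  rw [e] at h3
  refine h3.congr' ?_
  filter_upwards [eventually_gt_atTop 0] with n hn
  have hf : ((2 * n).factorial : ℝ) = n.centralBinom * (n.factorial:ℝ)^2 := by
    have := Nat.choose_mul_factorial_mul_factorial (show n ≤ 2 * n by omega)
    rw [show 2 * n - n = n by omega] at this
    rw [← this, Nat.centralBinom]; push_cast; ring
  simp only [Pi.div_apply, Stirling.stirlingSeq]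
  rw [hf]
  have hn' : (0:ℝ) < n := by exact_mod_cast hn
  have s1 : √(2 * (n:ℝ)) ^ 2 = 2 * n := Real.sq_sqrt (by positivity)
  have s2 : √(2 * ((2 * n : ℕ):ℝ)) = 2 * √n := by
    rw [show (2 * ((2 * n : ℕ):ℝ)) = 2^2 * n by push_cast; ring, Real.sqrt_mul (by positivity), Real.sqrt_sq (by norm_num)]
  have s3 : √(n:ℝ) ^ 2 = n := Real.sq_sqrt hn'.le
  rw [s2]
  simp only [div_pow, mul_pow]
  rw [s1]
  push_cast
  have s4 : ((2:ℝ) * n) ^ (2 * n) = 4 ^ n * n ^ (2*n) := by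
    rw [mul_pow, pow_mul 2 2 n]; norm_num
  have s5 : (n:ℝ)^(2*n) = (n ^ n)^2 := by ring
  have s6 : (Real.exp 1)^(2*n) = (Real.exp 1 ^ n)^2 := by ring
  rw [s4, s5, s6]
  have : √(n:ℝ) ≠ 0 := by positivity
  field_simp
  try rw [s3]
  try ring

lemma uu_tendsto : Tendsto (fun n : ℕ => uu n * (n:ℝ) ^ ((3:ℝ)/2)) atTop (𝓝 (-(1 / (2 * √Real.pi)))) := by
  rw [← tendsto_add_atTop_iff_nat 1]
  have h1 : Tendsto (fun n : ℕ => √(((n:ℝ)+1)/n)) atTop (𝓝 1) := by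
    have : Tendsto (fun n : ℕ => 1 + 1/(n:ℝ)) atTop (𝓝 (1 + 0)) := 
      tendsto_const_nhds.add tendsto_one_div_atTop_nhds_zero_nat
    have h := this.sqrt
    simp only [add_zero, Real.sqrt_one] at h
    refine h.congr' ?_
    filter_upwards [eventually_gt_atTop 0] with n hn
    congr 1
    field_simp
  have h2 := (cb_tendsto.mul h1).const_mul (-(1/2))
  have e : -(1 / 2) * (1 / √Real.pi * 1) = -(1 / (2 * √Real.pi)) := by field_simp
  rw [e] at h2
  refine h2.congr' ?_
  filter_upwards [eventually_gt_atTop 0] with n hn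
  have hn' : (0:ℝ) < n := by exact_mod_cast hn
  have h1 : ((n+1 : ℝ)) * catalan n = n.centralBinom := by exact_mod_cast succ_mul_catalan_eq_centralBinom n
  rw [← h1, show (3:ℝ)/2 = 1 + 1/2 by norm_num, Real.rpow_add (by positivity), Real.rpow_one, ← Real.sqrt_eq_rpow]
  rw [Real.sqrt_div (by positivity)]
  push_cast
  simp only [uu]
  have : √(n:ℝ) ≠ 0 := by positivity
  field_simp

lemma uu_bound : ∃ C : ℝ, 0 ≤ C ∧ ∀ n : ℕ, |uu n| * ((n:ℝ)+1) ^ ((3:ℝ)/2) ≤ C := by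
  have h := uu_tendsto.abs
  obtain ⟨C, hC⟩ := h.bddAbove_range
  refine ⟨max 1 (2 ^ ((3:ℝ)/2) * C), by positivity, fun n => ?_⟩
  rcases Nat.eq_zero_or_pos n with rfl | hn
  · simp [uu]
  · apply le_max_of_le_right
    have hn' : (1:ℝ) ≤ n := by exact_mod_cast hn
    have h1 := hC ⟨n, rfl⟩
    simp only [abs_mul] at h1
    rw [abs_of_nonneg (a := (n:ℝ) ^ ((3:ℝ)/2)) (by positivity)] at h1
    calc |uu n| * ((n:ℝ)+1) ^ ((3:ℝ)/2) ≤ |uu n| * (2 * n) ^ ((3:ℝ)/2) := by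
          gcongr; linarith
      _ = 2 ^ ((3:ℝ)/2) * (|uu n| * n ^ ((3:ℝ)/2)) := by
          rw [Real.mul_rpow (by norm_num) (by positivity)]; ring
      _ ≤ _ := by gcongr

lemma uu_summable (r : ℝ) (h0 : 0 ≤ r) (h1 : r < 1) : Summable (fun n => ‖uu n * r ^ n‖) := by
  obtain ⟨C, hC0, hC⟩ := uu_bound
  refine Summable.of_nonneg_of_le (fun _ => norm_nonneg _) (fun n => ?_) ((summable_geometric_of_lt_one h0 h1).mul_left C)
  rw [norm_mul, norm_pow, Real.norm_of_nonneg h0, Real.norm_eq_abs]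
  gcongr
  refine le_trans ?_ (hC n)
  apply le_mul_of_one_le_right (abs_nonneg _)
  apply Real.one_le_rpow _ (by norm_num)
  have : (0:ℝ) ≤ n := by positivity
  linarith

lemma uu_tsum (r : ℝ) (h0 : 0 ≤ r) (h1 : r < 1) : ∑' n, uu n * r ^ n = √(1 - r) := by
  have hs := uu_summable r h0 h1
  have hnn : 0 ≤ ∑' n, uu n * r ^ n := by
    refine ge_of_tendsto' (hs.of_norm.hasSum.tendsto_sum_nat.comp (tendsto_add_atTop_nat 1)) fun n => ?_
    have : (0:ℝ) ≤ ∑ i ∈ range (n+1), uu i := by rw [uu_sum]; positivity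
    refine this.trans (Finset.sum_le_sum fun i _ => ?_)
    rcases i with _ | i
    · simp
    · have hu : uu (i+1) ≤ 0 := by
        simp only [uu]; rw [neg_div]; apply neg_nonpos.2; positivity
      have : r ^ (i+1) ≤ 1 := pow_le_one₀ h0 h1.le
      nlinarith
  have hsq : (∑' n, uu n * r ^ n) ^ 2 = 1 - r := by
    rw [sq, tsum_mul_tsum_eq_tsum_sum_antidiagonal_of_summable_norm hs hs]
    have : ∀ n, ∑ kl ∈ antidiagonal n, (uu kl.1 * r ^ kl.1) * (uu kl.2 * r ^ kl.2) = 
        (if n = 0 then 1 else if n = 1 then -1 else 0) * r ^ n := by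
      intro n
      have h := congrArg (PowerSeries.coeff n) uu_sq
      rw [sq, PowerSeries.coeff_mul] at h
      simp only [PowerSeries.coeff_mk, map_sub, PowerSeries.coeff_one, PowerSeries.coeff_X] at h
      have h' : (if n = 0 then (1:ℝ) else if n = 1 then -1 else 0) = (if n = 0 then 1 else 0) - if n = 1 then 1 else 0 := by
        split_ifs <;> simp_all
      rw [h', ← h, Finset.sum_mul]
      apply Finset.sum_congr rfl
      intro kl hkl
      rw [← mem_antidiagonal.1 hkl, pow_add]
      ring
    simp_rw [this]
    rw [tsum_eq_sum (s := range 2)]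
    · simp [Finset.sum_range_succ]; ring
    · intro b hb
      simp at hb
      rw [if_neg (by omega), if_neg (by omega), zero_mul]
  rw [← hsq, Real.sqrt_sq hnn]

lemma conv_tendsto (r : ℝ) (h0 : 0 ≤ r) (h1 : r < 1) :
    Tendsto (fun m : ℕ => (m:ℝ) ^ ((3:ℝ)/2) * ∑ i ∈ range (m+2), (uu i * r ^ i) * uu (m + 1 - i)) atTop
      (𝓝 (√(1-r) * (-(1 / (2 * √Real.pi))))) := by
  obtain ⟨C, hC0, hC⟩ := uu_bound
  have key : Tendsto (fun m : ℕ => ∑' i, if i < m + 2 then (uu i * r ^ i) * (uu (m+1-i) * (m:ℝ) ^ ((3:ℝ)/2)) else 0) atTop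
      (𝓝 (∑' i, (uu i * r ^ i) * (-(1 / (2 * √Real.pi))))) := by
    refine tendsto_tsum_of_dominated_convergence (bound := fun i => C * C * r ^ i) 
      ((summable_geometric_of_lt_one h0 h1).mul_left _) (fun i => ?_) (Eventually.of_forall fun m i => ?_)
    · have h2 : Tendsto (fun m : ℕ => (uu i * r ^ i) * (uu (m+1-i) * (m:ℝ) ^ ((3:ℝ)/2))) atTop (𝓝 ((uu i * r ^ i) * (-(1 / (2 * √Real.pi))))) := by
        apply Tendsto.const_mul
        rw [← tendsto_add_atTop_iff_nat i]
        have h3 : Tendsto (fun m : ℕ => (((m:ℝ)+i)/(m+1)) ^ ((3:ℝ)/2)) atTop (𝓝 1) := by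
          have : Tendsto (fun m : ℕ => 1 + ((i:ℝ)-1) * (1/((m:ℝ)+1))) atTop (𝓝 (1 + ((i:ℝ)-1) * 0)) :=
            tendsto_const_nhds.add (tendsto_one_div_add_atTop_nhds_zero_nat.const_mul _)
          have h := this.rpow_const (p := (3:ℝ)/2) (by right; norm_num)
          simp only [mul_zero, add_zero, Real.one_rpow] at h
          refine h.congr fun m => ?_
          congr 1
          field_simp
          ring
        have h4 := ((tendsto_add_atTop_iff_nat 1).2 uu_tendsto).mul h3
        rw [mul_one] at h4
        refine h4.congr fun m => ?_
        rw [show m + i + 1 - i = m + 1 by omega, Real.div_rpow (by positivity) (by positivity)]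
        push_cast
        have : ((m:ℝ)+1) ^ ((3:ℝ)/2) ≠ 0 := by positivity
        field_simp
      refine h2.congr' ?_
      filter_upwards [eventually_ge_atTop i] with m hm
      rw [if_pos (by omega)]
    · split_ifs with hi
      · rw [norm_mul, norm_mul, norm_mul, norm_pow, Real.norm_of_nonneg h0, Real.norm_eq_abs, Real.norm_eq_abs,
          Real.norm_of_nonneg (by positivity : (0:ℝ) ≤ (m:ℝ) ^ ((3:ℝ)/2))]
        have hm : (m:ℝ) ≤ ((i:ℝ)+1) * (((m+1-i : ℕ):ℝ)+1) := by
          have : m ≤ (i+1) * ((m+1-i)+1) := by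
            obtain ⟨k, hk⟩ := Nat.exists_eq_add_of_le (show i ≤ m + 1 by omega)
            rw [hk, show i + k - i = k by omega]
            nlinarith
          exact_mod_cast this
        calc |uu i| * r ^ i * (|uu (m+1-i)| * (m:ℝ) ^ ((3:ℝ)/2)) 
            ≤ |uu i| * r ^ i * (|uu (m+1-i)| * (((i:ℝ)+1) * (((m+1-i : ℕ):ℝ)+1)) ^ ((3:ℝ)/2)) := by gcongr
          _ = (|uu i| * ((i:ℝ)+1)^ ((3:ℝ)/2)) * (|uu (m+1-i)| * (((m+1-i : ℕ):ℝ)+1) ^ ((3:ℝ)/2)) * r ^ i := by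
            rw [Real.mul_rpow (by positivity) (by positivity)]; ring
          _ ≤ C * C * r ^ i := by
            gcongr
            · exact hC i
            · exact hC _
      · simp; positivity
  rw [tsum_mul_right, uu_tsum r h0 h1] at key
  refine key.congr fun m => ?_
  rw [tsum_eq_sum (s := range (m+2)), Finset.mul_sum]
  · apply Finset.sum_congr rfl
    intro i hi
    rw [if_pos (mem_range.1 hi)]; ring
  · intro i hi
    rw [if_neg (by simpa using hi)]

lemma dyckG_eq_WW (m : ℕ) (y : ℝ) : dyckG m y = WW y (2 * m) 0 0 := by
  classical
  unfold dyckG WW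
  apply Finset.sum_congr rfl
  intro s _
  refine if_congr ?_ ?_ rfl
  · unfold IsDyck OKW dyckHeight
    simp only [Finset.sum_filter, zero_add, Fin.is_lt, if_true]
  · congr 1
    unfold upEven upW
    rw [Finset.card_filter]
    simp

/-- the square root of the discriminant -/
noncomputable def KK (a b : ℝ) : PowerSeries ℝ :=
  PowerSeries.rescale b (PowerSeries.mk uu) * PowerSeries.rescale a (PowerSeries.mk uu)

lemma KK_sq (a b : ℝ) : KK a b ^ 2 =
    (1 - PowerSeries.C b * PowerSeries.X) * (1 - PowerSeries.C a * PowerSeries.X) := by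
  unfold KK
  rw [mul_pow, ← map_pow, ← map_pow, uu_sq]
  simp [PowerSeries.rescale_X]

lemma KK_zero (a b : ℝ) : PowerSeries.constantCoeff (KK a b) = 1 := by
  unfold KK
  rw [map_mul, ← PowerSeries.coeff_zero_eq_constantCoeff_apply, ← PowerSeries.coeff_zero_eq_constantCoeff_apply]
  simp [PowerSeries.coeff_rescale, uu]

lemma dyckG_eq (y a b : ℝ) (hy : y ≠ 0) (hab : a * b = (y-1)^2) (hab' : a + b = 2 * (y+1)) (m : ℕ) (hm : 0 < m) :
    dyckG m y = - (1/2) * PowerSeries.coeff (m+1) (KK a b) := by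
  have hK := KK_sq a b
  have hK0 := KK_zero a b
  set K := KK a b with hKdef
  have hab1 : PowerSeries.C a * PowerSeries.C b = (PowerSeries.C y - 1)^2 := by
    rw [← map_mul, hab]; simp
  have c2 : PowerSeries.C (2:ℝ) = 2 := map_ofNat PowerSeries.C 2
  have hab2 : PowerSeries.C a + PowerSeries.C b = 2 * (PowerSeries.C y + 1) := by
    rw [← map_add, hab']; simp [c2]
  -- K = 1 + X K'
  have hdiv : PowerSeries.X ∣ (1 - K) := by
    rw [PowerSeries.X_dvd_iff]; simp [hK0]
  obtain ⟨K', hK'⟩ := hdiv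
  set h : PowerSeries ℝ := PowerSeries.C (1/2:ℝ)
  have e2 : 2 * h = 1 := by
    rw [← c2, ← map_mul]; norm_num
  set v : PowerSeries ℝ := PowerSeries.C (1/y)
  have ev : PowerSeries.C y * v = 1 := by
    rw [← map_mul]; simp [hy]
  have hKe : K = 1 - PowerSeries.X * K' := by linear_combination -hK'
  have hX : (PowerSeries.X : PowerSeries ℝ) ≠ 0 := PowerSeries.X_ne_zero
  let G := h * (K' - (PowerSeries.C y - 1))
  have hGdef : K' = 2 * G + (PowerSeries.C y - 1) := by
    simp only [G]; linear_combination -(K' - (PowerSeries.C y - 1)) * e2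
  have hK2 : K = 1 - PowerSeries.X * (2 * G + (PowerSeries.C y - 1)) := by rw [← hGdef]; exact hKe
  -- quadratic equation
  have hquad : PowerSeries.X * G ^ 2 - G * (1 - PowerSeries.X * (PowerSeries.C y - 1)) + 1 = 0 := by
    have h4 : (4 : PowerSeries ℝ) * PowerSeries.X ≠ 0 := by
      apply mul_ne_zero _ hX
      intro h4
      have := congrArg PowerSeries.constantCoeff h4
      rw [map_ofNat, map_zero] at this
      norm_num at this
    refine (mul_eq_zero.1 (?_ : ((4 : PowerSeries ℝ) * PowerSeries.X) * _ = 0)).resolve_left h4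
    rw [hK2] at hK
    linear_combination hK + PowerSeries.X^2 * hab1 - PowerSeries.X * hab2
  let Q := v * (G - 1)
  have hGQ : G = 1 + PowerSeries.C y * Q := by
    simp only [Q]; linear_combination -(G - 1) * ev
  have hy' : PowerSeries.C y ≠ 0 := by
    intro h0; rw [h0] at ev; simp at ev
  have hQ : Q = PowerSeries.X * (PowerSeries.C y * Q ^ 2 + PowerSeries.C (y+1) * Q + 1) := by
    apply mul_left_cancel₀ hy'
    rw [map_add, map_one]
    rw [hGQ] at hquad
    linear_combination -hquad
  have hG : G = 1 + PowerSeries.X * (PowerSeries.C y * (G * Q) + PowerSeries.C y * G) := by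
    rw [map_add, map_one] at hQ
    rw [hGQ]
    linear_combination PowerSeries.C y * hQ
  have := WW_two y G Q hG hQ m 0 0 rfl
  rw [dyckG_eq_WW]
  simp only [pow_zero, mul_one, Nat.cast_zero, mul_zero] at this
  rw [this, hK2]
  clear_value G
  obtain ⟨n, rfl⟩ : ∃ n, m = n + 1 := ⟨m - 1, by omega⟩
  rw [map_sub, PowerSeries.coeff_succ_X_mul, map_add, map_sub, ← c2, PowerSeries.coeff_C_mul]
  simp [PowerSeries.coeff_one, PowerSeries.coeff_C]

lemma KK_coeff (a b : ℝ) (ha : a ≠ 0) (m : ℕ) : PowerSeries.coeff (m+1) (KK a b) =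
    a ^ (m+1) * ∑ i ∈ range (m+2), (uu i * (b/a) ^ i) * uu (m + 1 - i) := by
  unfold KK
  rw [PowerSeries.coeff_mul, Finset.Nat.sum_antidiagonal_eq_sum_range_succ_mk, Finset.mul_sum]
  apply Finset.sum_congr rfl
  intro i hi
  have hi' : i ≤ m + 1 := by have := mem_range.1 hi; omega
  simp only [PowerSeries.coeff_rescale, PowerSeries.coeff_mk]
  obtain ⟨k, hk⟩ := Nat.exists_eq_add_of_le hi'
  rw [hk, show i + k - i = k by omega, pow_add, div_pow]
  field_simp

/-- **Formula (4.7)** of Soshnikov.  For fixed `y > 1`, as `m → ∞`,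
`g_m(y) = (y^{1/4}(√y+1)/(2√π)) · (√y+1)^{2m} / m^{3/2} · (1+o(1))`; equivalently
`m^{3/2} g_m(y) (√y+1)^{−2m} → y^{1/4}(√y+1)/(2√π)`. -/
theorem dyckG_asymptotics (y : ℝ) (hy : 1 < y) :
    Filter.Tendsto
      (fun m : ℕ => (m : ℝ) ^ ((3 : ℝ) / 2) * dyckG m y / (Real.sqrt y + 1) ^ (2 * m))
      Filter.atTop
      (nhds (y ^ ((1 : ℝ) / 4) * (Real.sqrt y + 1) / (2 * Real.sqrt Real.pi))) := by
  obtain ⟨q, hq0, hq⟩ : ∃ q : ℝ, 0 < q ∧ q = y ^ ((1:ℝ)/4) := ⟨_, by positivity, rfl⟩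
  have hqs : Real.sqrt y = q ^ 2 := by
    rw [hq, Real.sqrt_eq_rpow, ← Real.rpow_natCast, ← Real.rpow_mul (by linarith)]; norm_num
  have hqy : y = q ^ 4 := by
    have := Real.sq_sqrt (by linarith : (0:ℝ) ≤ y)
    rw [hqs] at this; rw [← this]; ring
  rw [← hq, hqs]
  set a : ℝ := (q^2+1)^2 with ha
  set b : ℝ := (q^2-1)^2 with hb
  have ha0 : 0 < a := by positivity
  have hb0 : 0 ≤ b := by positivity
  have hba : b < a := by rw [ha, hb]; nlinarith [sq_pos_of_pos hq0]
  have hr1 : b / a < 1 := (div_lt_one ha0).2 hba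
  have hsq : √(1 - b / a) = 2 * q / (q^2+1) := by
    rw [show 1 - b / a = (2 * q / (q^2+1))^2 by rw [ha, hb]; field_simp; ring]
    exact Real.sqrt_sq (by positivity)
  have h := (conv_tendsto (b/a) (by positivity) hr1).const_mul (-(1/2) * a)
  rw [hsq] at h
  have hp : √Real.pi ≠ 0 := by positivity
  have e : -(1 / 2) * a * (2 * q / (q ^ 2 + 1) * -(1 / (2 * √Real.pi))) = q * (q ^ 2 + 1) / (2 * √Real.pi) := by
    rw [ha]; field_simp
  rw [e] at h
  refine h.congr' ?_
  filter_upwards [eventually_gt_atTop 0] with m hm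
  rw [dyckG_eq y a b (by linarith) (by rw [ha, hb, hqy]; ring) (by rw [ha, hb, hqy]; ring) m hm, KK_coeff a b ha0.ne',
    pow_mul, ← ha, pow_succ]
  field_simp
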